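/- Let A be a symmetric real 3×3 matrix such that Ā = (tr(A)I − A)/2 is positive definite, with smallest and largest eigenvalues λ_min and λ_max. Let ε > 0 and γ > 0 satisfy γ < (1+ε)^{−1}, and set ξ₀ = 1 − γε/(1−γ). Let R̃ : [0,∞) → ℝ^{3×3} be differentiable with R̃(t) ∈ SO(3) and R̃'(t) = R̃(t)[σ(t)]_×, where σ(t) = −ψ(A R̃(t)) / (1 + ε − |R̃(t)|_I²), and suppose |R̃(0)|_I² < ξ₀. Then for all t ≥ 0, |R̃(0)|_I e^{−λ_max t} ≤ |R̃(t)|_I ≤ |R̃(0)|_I e^{−γ λ_min t}. -/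

import Mathlib

open Matrix Filter

noncomputable section

attribute [local instance] Matrix.normedAddCommGroup Matrix.normedSpace

/-- 3×3 real matrices. -/
abbrev M3 := Matrix (Fin 3) (Fin 3) ℝ
/-- vectors in ℝ³. -/
abbrev V3 := Fin 3 → ℝ

/-- `R ∈ SO(3)`: `RᵀR = I` and `det R = 1`. -/
def SO3 (R : M3) : Prop := Rᵀ * R = 1 ∧ R.det = 1

/-- The skew-symmetric matrix `[x]ₓ` with `[x]ₓ y = x × y`. -/
def skew (x : V3) : M3 :=
  !![0, -x 2, x 1; x 2, 0, -x 0; -x 1, x 0, 0]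

/-- Inverse of `skew` on skew-symmetric matrices. -/
def vex (M : M3) : V3 := ![M 2 1, M 0 2, M 1 0]

/-- Anti-symmetric projection `P_a(M) = (M - Mᵀ)/2`. -/
def Pa (M : M3) : M3 := (2:ℝ)⁻¹ • (M - Mᵀ)

/-- `ψ(M) = vex(P_a(M))`. -/
def psi (M : M3) : V3 := vex (Pa M)

/-- Squared normalized Euclidean distance `|R|_I² = tr(I - R)/4`. -/
def normI2 (R : M3) : ℝ := (1 - R).trace / 4

/-- Rodrigues vector `Z(R) = ψ(R)/(2(1 - |R|_I²))`. -/
def Zof (R : M3) : V3 := (2 * (1 - normI2 R))⁻¹ • psi R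

/-- Cayley map `R_r(z) = (I + [z]ₓ)(I - [z]ₓ)⁻¹`. -/
def Rr (z : V3) : M3 := (1 + skew z) * (1 - skew z)⁻¹

/-- Angle-axis map `R_a(θ,u) = I + sin θ [u]ₓ + (1 - cos θ)[u]ₓ²`. -/
def Ra (θ : ℝ) (u : V3) : M3 :=
  1 + Real.sin θ • skew u + (1 - Real.cos θ) • (skew u * skew u)

/-- `g(z) = (1/2)(I + [z]ₓ + z zᵀ)`. -/
def gmat (z : V3) : M3 := (2:ℝ)⁻¹ • ((1 : M3) + skew z + vecMulVec z z)

/-- `Ā = (tr(A) I - A)/2`. -/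
def Abar (A : M3) : M3 := (2:ℝ)⁻¹ • (A.trace • (1 : M3) - A)

/-- smallest eigenvalue of a positive-definite symmetric real matrix. -/
def lmin {B : M3} (hB : B.PosDef) : ℝ := ⨅ i, hB.1.eigenvalues i

/-- largest eigenvalue of a positive-definite symmetric real matrix. -/
def lmax {B : M3} (hB : B.PosDef) : ℝ := ⨆ i, hB.1.eigenvalues i

lemma psi_dotProduct_psi_mul {A R : M3} (hA : A.IsSymm) (hR : Rᵀ * R = 1) :
    psi R ⬝ᵥ psi (A * R) = psi R ⬝ᵥ (Abar A *ᵥ psi R) := by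
  have hR2 : R * Rᵀ = 1 := mul_eq_one_comm.mp hR
  have h : Rᵀ * R = R * Rᵀ := hR.trans hR2.symm
  have e := fun i j => congrFun (congrFun h i) j
  have h01 := e 0 1
  have h02 := e 0 2
  have h12 := e 1 2
  have h00 := e 0 0
  have h11 := e 1 1
  have h22 := e 2 2
  have a01 := hA.apply 0 1
  have a02 := hA.apply 0 2
  have a12 := hA.apply 1 2
  simp only [Matrix.mul_apply, Fin.sum_univ_three, Matrix.transpose_apply] at h00 h01 h02 h11 h12 h22
  simp [psi, vex, Pa, Abar, dotProduct, Matrix.mulVec, Matrix.mul_apply, Fin.sum_univ_three,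
    Matrix.trace, Matrix.one_apply, a01, a02, a12]
  linear_combination -(A 0 0 * h00 + A 1 1 * h11 + A 2 2 * h22 + 2 * A 0 1 * h01
    + 2 * A 0 2 * h02 + 2 * A 1 2 * h12) / 8

lemma SO3.psi_dotProduct_self {R : M3} (hR : SO3 R) :
    psi R ⬝ᵥ psi R = 4 * normI2 R * (1 - normI2 R) := by
  obtain ⟨h, hd⟩ := hR
  have hadj : R.adjugate = Rᵀ := by
    have h1 : R.adjugate * R = 1 := by rw [Matrix.adjugate_mul, hd, one_smul]
    have hR2 : R * Rᵀ = 1 := mul_eq_one_comm.mp h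
    calc R.adjugate = R.adjugate * (R * Rᵀ) := by rw [hR2, mul_one]
      _ = Rᵀ := by rw [← mul_assoc, h1, one_mul]
  have e := fun i j => congrFun (congrFun h i) j
  have a := fun i j => congrFun (congrFun hadj i) j
  have h00 := e 0 0
  have h11 := e 1 1
  have h22 := e 2 2
  have a00 := a 0 0
  have a11 := a 1 1
  have a22 := a 2 2
  simp [Matrix.mul_apply, Fin.sum_univ_three] at h00 h11 h22
  simp [Matrix.adjugate_fin_three] at a00 a11 a22
  simp [psi, vex, Pa, dotProduct, Fin.sum_univ_three, normI2, Matrix.trace]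
  linear_combination (h00 + h11 + h22) / 4 + (a00 + a11 + a22) / 2

lemma SO3.normI2_mem_Icc {R : M3} (hR : SO3 R) : normI2 R ∈ Set.Icc 0 1 := by
  have h := hR.psi_dotProduct_self
  have h0 : 0 ≤ psi R ⬝ᵥ psi R := by
    simp only [dotProduct]
    exact Finset.sum_nonneg fun i _ => mul_self_nonneg _
  constructor <;> nlinarith

lemma trace_mul_skew (R : M3) (x : V3) : (R * skew x).trace = -2 * (psi R ⬝ᵥ x) := by
  simp [psi, vex, Pa, skew, dotProduct, Matrix.mul_apply, Fin.sum_univ_three, Matrix.trace]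
  ring

lemma isHermitian_dotProduct_mulVec {B : M3} (hB : B.IsHermitian) (x : V3) :
    ∃ y : V3, y ⬝ᵥ y = x ⬝ᵥ x ∧ x ⬝ᵥ (B *ᵥ x) = ∑ i, hB.eigenvalues i * (y i * y i) := by
  set U : M3 := (hB.eigenvectorUnitary : M3)
  have hUU : U * Uᵀ = 1 := by
    have := Unitary.coe_mul_star_self hB.eigenvectorUnitary
    simpa [Matrix.star_eq_conjTranspose] using this
  have hs : B = U * Matrix.diagonal hB.eigenvalues * Uᵀ := by
    have := hB.spectral_theorem
    simpa [Unitary.conjStarAlgAut_apply, Matrix.star_eq_conjTranspose, Function.comp_def]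
      using this
  refine ⟨Uᵀ *ᵥ x, ?_, ?_⟩
  · rw [Matrix.dotProduct_mulVec, Matrix.vecMul_transpose, Matrix.mulVec_mulVec, hUU,
      Matrix.one_mulVec]
  · conv_lhs => rw [hs]
    rw [← Matrix.mulVec_mulVec, ← Matrix.mulVec_mulVec, Matrix.dotProduct_mulVec,
      ← Matrix.mulVec_transpose]
    simp only [dotProduct, Matrix.mulVec_diagonal]
    exact Finset.sum_congr rfl fun i _ => by ring

lemma lmin_mul_dotProduct_le {B : M3} (hB : B.PosDef) (x : V3) :
    lmin hB * (x ⬝ᵥ x) ≤ x ⬝ᵥ (B *ᵥ x) := by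
  obtain ⟨y, hy, h⟩ := isHermitian_dotProduct_mulVec hB.1 x
  rw [h, ← hy, dotProduct, Finset.mul_sum]
  exact Finset.sum_le_sum fun i _ => mul_le_mul_of_nonneg_right
    (ciInf_le (Set.finite_range _).bddBelow i) (mul_self_nonneg _)

lemma dotProduct_le_lmax_mul {B : M3} (hB : B.PosDef) (x : V3) :
    x ⬝ᵥ (B *ᵥ x) ≤ lmax hB * (x ⬝ᵥ x) := by
  obtain ⟨y, hy, h⟩ := isHermitian_dotProduct_mulVec hB.1 x
  rw [h, ← hy, dotProduct, Finset.mul_sum]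
  exact Finset.sum_le_sum fun i _ => mul_le_mul_of_nonneg_right
    (le_ciSup (Set.finite_range _).bddAbove i) (mul_self_nonneg _)

lemma lmin_pos {B : M3} (hB : B.PosDef) : 0 < lmin hB := by
  obtain ⟨i, hi⟩ := exists_eq_ciInf_of_finite (f := hB.1.eigenvalues)
  rw [lmin, ← hi]
  exact hB.eigenvalues_pos i

lemma lmax_pos {B : M3} (hB : B.PosDef) : 0 < lmax hB :=
  (hB.eigenvalues_pos 0).trans_le (le_ciSup (Set.finite_range _).bddAbove 0)

lemma HasDerivWithinAt.normI2 {R : ℝ → M3} {R' : M3} {s : Set ℝ} {t : ℝ}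
    (h : HasDerivWithinAt R R' s t) :
    HasDerivWithinAt (fun t => normI2 (R t)) (-R'.trace / 4) s t := by
  have hd : ∀ i, HasDerivWithinAt (fun t => R t i i) (R' i i) s t := fun i =>
    hasDerivWithinAt_pi.mp (hasDerivWithinAt_pi.mp h i) i
  have key := (((hd 0).add ((hd 1).add (hd 2))).const_sub 3).div_const 4
  refine (key.congr_deriv ?_).congr_of_eventuallyEq (.of_forall fun t => ?_) ?_ <;>
  · simp [_root_.normI2, Matrix.trace, Fin.sum_univ_three]
    ring

lemma le_mul_exp_of_hasDerivWithinAt_le {f f' : ℝ → ℝ} {c : ℝ}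
    (hf : ∀ t, 0 ≤ t → HasDerivWithinAt f (f' t) (Set.Ici 0) t)
    (hc : ∀ t, 0 ≤ t → f' t ≤ c * f t) {t : ℝ} (ht : 0 ≤ t) :
    f t ≤ f 0 * Real.exp (c * t) := by
  have hd : ∀ t, 0 ≤ t → HasDerivWithinAt (fun t => f t * Real.exp (-c * t))
      (f' t * Real.exp (-c * t) + f t * (Real.exp (-c * t) * (-c * 1))) (Set.Ici 0) t :=
    fun t ht => (hf t ht).mul (((hasDerivAt_id t).const_mul (-c)).exp.hasDerivWithinAt)
  have hanti : AntitoneOn (fun t => f t * Real.exp (-c * t)) (Set.Ici 0) := by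
    refine antitoneOn_of_hasDerivWithinAt_nonpos (convex_Ici 0)
      (fun t ht => (hd t ht).continuousWithinAt)
      (fun t ht => (hd t (interior_subset ht)).mono interior_subset) fun t ht => ?_
    have := mul_nonneg (sub_nonneg.mpr (hc t (interior_subset ht))) (Real.exp_pos (-c * t)).le
    linarith
  have h := hanti Set.self_mem_Ici (Set.mem_Ici.mpr ht) ht
  simp only [mul_zero, Real.exp_zero, mul_one, neg_mul, Real.exp_neg] at h
  rwa [← div_eq_mul_inv, div_le_iff₀ (Real.exp_pos _)] at h

lemma Real.sqrt_mul_exp (x c t : ℝ) :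
    √(x * Real.exp (-2 * c * t)) = √x * Real.exp (-c * t) := by
  rw [Real.sqrt_mul' _ (Real.exp_pos _).le, ← Real.exp_half]
  ring_nf

/-- exponential bounds for the Filter III error dynamics
`R̃' = R̃[σ]ₓ`, `σ = −ψ(AR̃)/(1 + ε − |R̃|_I²)`. -/
theorem stmt14 (A : M3) (hA : A.IsSymm) (hPD : (Abar A).PosDef)
    (ε γ : ℝ) (hε : 0 < ε) (hγ0 : 0 < γ) (hγ : γ < (1 + ε)⁻¹)
    (ξ₀ : ℝ) (hξ₀ : ξ₀ = 1 - γ * ε / (1 - γ))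
    (Rt : ℝ → M3) (σ : ℝ → V3)
    (hσ : ∀ t, σ t = -((1 + ε - normI2 (Rt t))⁻¹ • psi (A * Rt t)))
    (hSO : ∀ t, 0 ≤ t → SO3 (Rt t))
    (hR' : ∀ t, 0 ≤ t → HasDerivWithinAt Rt (Rt t * skew (σ t)) (Set.Ici 0) t)
    (h0 : normI2 (Rt 0) < ξ₀) :
    ∀ t, 0 ≤ t →
      Real.sqrt (normI2 (Rt 0)) * Real.exp (-(lmax hPD) * t) ≤
        Real.sqrt (normI2 (Rt t)) ∧
      Real.sqrt (normI2 (Rt t)) ≤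
        Real.sqrt (normI2 (Rt 0)) * Real.exp (-(γ * lmin hPD) * t) := by
  set V : ℝ → ℝ := fun t => normI2 (Rt t) with hV
  set q : ℝ → ℝ := fun t => psi (Rt t) ⬝ᵥ (Abar A *ᵥ psi (Rt t)) with hq
  have hV01 : ∀ t, 0 ≤ t → 0 ≤ V t ∧ V t ≤ 1 := fun t ht => (hSO t ht).normI2_mem_Icc
  have hden : ∀ t, 0 ≤ t → 0 < 1 + ε - V t := fun t ht => by linarith [(hV01 t ht).2]
  have hqmin : ∀ t, 0 ≤ t → lmin hPD * (4 * V t * (1 - V t)) ≤ q t := fun t ht => by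
    rw [← (hSO t ht).psi_dotProduct_self]
    exact lmin_mul_dotProduct_le hPD _
  have hqmax : ∀ t, 0 ≤ t → q t ≤ lmax hPD * (4 * V t * (1 - V t)) := fun t ht => by
    rw [← (hSO t ht).psi_dotProduct_self]
    exact dotProduct_le_lmax_mul hPD _
  have hder : ∀ t, 0 ≤ t →
      HasDerivWithinAt V (-(q t / (2 * (1 + ε - V t)))) (Set.Ici 0) t := fun t ht => by
    refine (hR' t ht).normI2.congr_deriv ?_
    rw [trace_mul_skew, hσ, dotProduct_neg, dotProduct_smul,
      psi_dotProduct_psi_mul hA (hSO t ht).1, smul_eq_mul]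
    have := (hden t ht).ne'
    simp only [hV, hq] at this ⊢
    field_simp
    ring
  have hmin := lmin_pos hPD
  have hmax := lmax_pos hPD
  have hle0 : ∀ t, 0 ≤ t → V t ≤ V 0 := fun t ht => by
    have h := le_mul_exp_of_hasDerivWithinAt_le (c := 0) hder (fun s hs => ?_) ht
    · simpa using h
    have hp : 0 ≤ q s := le_trans (mul_nonneg hmin.le
      (mul_nonneg (by linarith [(hV01 s hs).1]) (by linarith [(hV01 s hs).2]))) (hqmin s hs)
    have := div_nonneg hp (by linarith [hden s hs] : 0 ≤ 2 * (1 + ε - V s))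
    linarith
  have hγ1 : γ < 1 := hγ.trans (inv_lt_one_of_one_lt₀ (by linarith))
  have hgain : ∀ t, 0 ≤ t → γ * (1 + ε - V t) ≤ 1 - V t := fun t ht => by
    have h : γ * ε / (1 - γ) ≤ 1 - V t := by linarith [hle0 t ht, h0, hV]
    rw [div_le_iff₀ (by linarith)] at h
    linarith
  intro t ht
  constructor
  · have h := le_mul_exp_of_hasDerivWithinAt_le (f := -V) (c := -2 * lmax hPD)
      (fun s hs => (hder s hs).neg) (fun s hs => ?_) ht
    · rw [← Real.sqrt_mul_exp]
      refine Real.sqrt_le_sqrt ?_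
      simp only [Pi.neg_apply] at h
      linarith
    obtain ⟨hs0, hs1⟩ := hV01 s hs
    have := hden s hs
    rw [neg_neg, div_le_iff₀ (by linarith)]
    have h1 := mul_nonneg (mul_nonneg hmax.le hs0) hε.le
    simp only [Pi.neg_apply]
    linarith [hqmax s hs]
  · have h := le_mul_exp_of_hasDerivWithinAt_le (c := -2 * (γ * lmin hPD)) hder
      (fun s hs => ?_) ht
    · rw [← Real.sqrt_mul_exp]
      exact Real.sqrt_le_sqrt h
    obtain ⟨hs0, hs1⟩ := hV01 s hs
    have := hden s hs
    have h1 := mul_le_mul_of_nonneg_left (hgain s hs) (mul_nonneg hmin.le hs0)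
    have h2 : 2 * (γ * lmin hPD) * V s ≤ q s / (2 * (1 + ε - V s)) := by
      rw [le_div_iff₀ (by linarith)]
      linarith [hqmin s hs]
    linarith

end
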